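/- arXiv:1210.5865 — 2 statements merged into one kernel-verified Lean document; each statement's English description precedes it below -/
import Mathlib

section
/- Let μ be a Borel measure on (T, d). Then for every x ∈ T and r > 0, μ(B(x,r)) ≤ μ({y ∈ T : D(x,y) < r}) ≤ (2J + 1) · sup_{z ∈ T} μ(B(z,r)). (The middle quantity equals the measure, under the pushforward of μ to the glued space T/∼, of the open ball of radius r about the class of x in the quotient metric, since {y : D(x,y) < r} is the preimage of that ball under the quotient map.) -/
/-- The base relation for gluing: `x` is related to `y` iff `(x, y) = (u i, v i)` for some `i`. -/
def glueBase {T : Type*} {J : ℕ} (u v : Fin J → T) : T → T → Prop :=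
  fun x y => ∃ i : Fin J, x = u i ∧ y = v i

/-- The smallest equivalence relation on `T` identifying `u i` with `v i` for each `i`. -/
def glueEquiv {T : Type*} {J : ℕ} (u v : Fin J → T) : T → T → Prop :=
  Relation.EqvGen (glueBase u v)

/-- The glued (quotient) distance: the infimum over all chains
`x = x₁, y₁ ∼ x₂, y₂ ∼ x₃, …, y_k = y` of `∑ d(xᵢ, yᵢ)`. -/
noncomputable def glueDist {T : Type*} [MetricSpace T] {J : ℕ} (u v : Fin J → T)
    (x y : T) : ℝ :=
  sInf { s : ℝ | ∃ (k : ℕ) (xs ys : Fin (k + 1) → T),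
    xs 0 = x ∧ ys (Fin.last k) = y ∧
    (∀ i : Fin k, glueEquiv u v (ys i.castSucc) (xs i.succ)) ∧
    s = ∑ i, dist (xs i) (ys i) }

/-- The set `W` of glued points. -/
def glueSet {T : Type*} {J : ℕ} (u v : Fin J → T) : Set T :=
  Set.range u ∪ Set.range v


open MeasureTheory

/-- Distinct equivalent points are both glued points. -/
theorem glueEquiv.eq_or_mem_glueSet {T : Type*} {J : ℕ} {u v : Fin J → T} {p q : T}
    (h : glueEquiv u v p q) : p = q ∨ (p ∈ glueSet u v ∧ q ∈ glueSet u v) := by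
  induction h with
  | rel p q h =>
    obtain ⟨i, rfl, rfl⟩ := h
    exact Or.inr ⟨Or.inl ⟨i, rfl⟩, Or.inr ⟨i, rfl⟩⟩
  | refl p => exact Or.inl rfl
  | symm p q _ ih => exact ih.imp Eq.symm And.symm
  | trans p q s _ _ ih₁ ih₂ =>
    rcases ih₁ with rfl | h₁
    · exact ih₂
    · rcases ih₂ with rfl | h₂
      · exact Or.inr h₁
      · exact Or.inr ⟨h₁.1, h₂.2⟩

/-- The endpoint of a chain is as close to the starting point or to some glued point as the
length of the chain. -/
theorem exists_dist_le_sum_of_glueEquiv_chain {T : Type*} [MetricSpace T] {J : ℕ}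
    {u v : Fin J → T} (k : ℕ) (xs ys : Fin (k + 1) → T)
    (h : ∀ i : Fin k, glueEquiv u v (ys i.castSucc) (xs i.succ)) :
    ∃ a, (a = xs 0 ∨ a ∈ glueSet u v) ∧ dist a (ys (Fin.last k)) ≤ ∑ i, dist (xs i) (ys i) := by
  induction k with
  | zero => exact ⟨xs 0, Or.inl rfl, by simp⟩
  | succ k ih =>
    obtain ⟨a, ha, hle⟩ := ih (fun i => xs i.castSucc) (fun i => ys i.castSucc)
      fun i => h i.castSucc
    rw [Fin.sum_univ_castSucc]
    rcases (h (Fin.last k)).eq_or_mem_glueSet with heq | ⟨-, hmem⟩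
    · refine ⟨a, ha, (dist_triangle a (ys (Fin.last k).castSucc) _).trans (add_le_add hle ?_)⟩
      rw [heq, Fin.succ_last]
    · refine ⟨_, Or.inr hmem, ?_⟩
      rw [Fin.succ_last]
      exact le_add_of_nonneg_left (Finset.sum_nonneg fun _ _ => dist_nonneg)

theorem glueDist_le_dist {T : Type*} [MetricSpace T] {J : ℕ} (u v : Fin J → T) (x y : T) :
    glueDist u v x y ≤ dist x y := by
  refine csInf_le ⟨0, ?_⟩
    ⟨0, fun _ => x, fun _ => y, rfl, rfl, fun i => i.elim0, by simp⟩
  rintro s ⟨k, xs, ys, -, -, -, rfl⟩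
  exact Finset.sum_nonneg fun _ _ => dist_nonneg

theorem exists_dist_lt_of_glueDist_lt {T : Type*} [MetricSpace T] {J : ℕ} {u v : Fin J → T}
    {x y : T} {r : ℝ} (h : glueDist u v x y < r) :
    ∃ a, (a = x ∨ a ∈ glueSet u v) ∧ dist a y < r := by
  rw [glueDist] at h
  obtain ⟨s, ⟨k, xs, ys, rfl, rfl, hk, rfl⟩, hs⟩ := exists_lt_of_csInf_lt (by
    exact ⟨_, 0, fun _ => x, fun _ => y, rfl, rfl, fun i => i.elim0, rfl⟩) h
  obtain ⟨a, ha, hle⟩ := exists_dist_le_sum_of_glueEquiv_chain k xs ys hk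
  exact ⟨a, ha, hle.trans_lt hs⟩

theorem setOf_glueDist_lt_subset {T : Type*} [MetricSpace T] {J : ℕ} (u v : Fin J → T)
    (x : T) (r : ℝ) :
    { y : T | glueDist u v x y < r } ⊆
      Metric.ball x r ∪ ((⋃ i, Metric.ball (u i) r) ∪ ⋃ i, Metric.ball (v i) r) := by
  intro y hy
  obtain ⟨a, rfl | ⟨i, rfl⟩ | ⟨i, rfl⟩, hlt⟩ := exists_dist_lt_of_glueDist_lt hy
  · exact Or.inl (Metric.mem_ball'.2 hlt)
  · exact Or.inr (Or.inl (Set.mem_iUnion.2 ⟨i, Metric.mem_ball'.2 hlt⟩))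
  · exact Or.inr (Or.inr (Set.mem_iUnion.2 ⟨i, Metric.mem_ball'.2 hlt⟩))

theorem measure_iUnion_ball_le {T : Type*} [MetricSpace T] [MeasurableSpace T] {J : ℕ}
    (w : Fin J → T) (μ : Measure T) (r : ℝ) :
    μ (⋃ i, Metric.ball (w i) r) ≤ J * ⨆ z : T, μ (Metric.ball z r) := by
  calc μ (⋃ i, Metric.ball (w i) r) ≤ ∑ i, μ (Metric.ball (w i) r) :=
        measure_iUnion_fintype_le μ _
    _ ≤ ∑ _i : Fin J, ⨆ z : T, μ (Metric.ball z r) :=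
        Finset.sum_le_sum fun i _ => le_iSup (fun z => μ (Metric.ball z r)) (w i)
    _ = J * ⨆ z : T, μ (Metric.ball z r) := by simp

/-- For a Borel measure `μ` on `(T, d)`, the measure of the ball of radius `r` about `x̄` in the
glued space (equivalently, of `{y : D(x,y) < r}` in `T`) is sandwiched between `μ(B(x,r))` and
`(2J + 1) ⋅ sup_z μ(B(z,r))`. -/
theorem glueDist_ball_measure_bounds {T : Type*} [MetricSpace T] [MeasurableSpace T]
    [BorelSpace T] {J : ℕ} (u v : Fin J → T) (μ : Measure T) (x : T) (r : ℝ) (hr : 0 < r) :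
    μ (Metric.ball x r) ≤ μ { y : T | glueDist u v x y < r } ∧
      μ { y : T | glueDist u v x y < r } ≤
        (2 * J + 1) * ⨆ z : T, μ (Metric.ball z r) := by
  refine ⟨measure_mono fun y hy => (glueDist_le_dist u v x y).trans_lt (Metric.mem_ball'.1 hy), ?_⟩
  calc μ { y : T | glueDist u v x y < r }
      ≤ μ (Metric.ball x r) +
          (μ (⋃ i, Metric.ball (u i) r) + μ (⋃ i, Metric.ball (v i) r)) :=
        (measure_mono (setOf_glueDist_lt_subset u v x r)).trans
          ((measure_union_le _ _).trans (add_le_add le_rfl (measure_union_le _ _)))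
    _ ≤ (⨆ z : T, μ (Metric.ball z r)) +
          (J * (⨆ z : T, μ (Metric.ball z r)) + J * ⨆ z : T, μ (Metric.ball z r)) :=
        add_le_add (le_iSup (fun z => μ (Metric.ball z r)) x)
          (add_le_add (measure_iUnion_ball_le u μ r) (measure_iUnion_ball_le v μ r))
    _ = (2 * J + 1) * ⨆ z : T, μ (Metric.ball z r) := by ring
end

section
/- For every x ∈ T and r > 0, the D-ball about x is contained in the union of the d-balls about x and about the glued points: {y ∈ T : D(x,y) < r} ⊆ B(x,r) ∪ ⋃_{w ∈ W} B(w,r). -/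
/-- Two glued points are either equal or both lie in the set of glued points. -/
theorem glueEquiv.eq_or_mem {T : Type*} {J : ℕ} {u v : Fin J → T} {a b : T}
    (h : glueEquiv u v a b) : a = b ∨ (a ∈ glueSet u v ∧ b ∈ glueSet u v) := by
  induction h with
  | rel a b h =>
    obtain ⟨i, rfl, rfl⟩ := h
    exact Or.inr ⟨Or.inl ⟨i, rfl⟩, Or.inr ⟨i, rfl⟩⟩
  | refl a => exact Or.inl rfl
  | symm a b _ ih => exact ih.imp Eq.symm And.symm
  | trans a b c _ _ ihab ihbc =>
    rcases ihab with rfl | hab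
    · exact ihbc
    · rcases ihbc with rfl | hbc
      · exact Or.inr hab
      · exact Or.inr ⟨hab.1, hbc.2⟩

/-- The length of a chain bounds the distance from its endpoint to its starting point or to some
glued point. -/
theorem dist_le_sum_of_glue_chain {T : Type*} [MetricSpace T] {J : ℕ} {u v : Fin J → T} {k : ℕ}
    (xs ys : Fin (k + 1) → T)
    (h : ∀ i : Fin k, glueEquiv u v (ys i.castSucc) (xs i.succ)) :
    ∃ w, (w = xs 0 ∨ w ∈ glueSet u v) ∧
      dist w (ys (Fin.last k)) ≤ ∑ i, dist (xs i) (ys i) := by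
  induction k with
  | zero => exact ⟨xs 0, Or.inl rfl, by simp⟩
  | succ k ih =>
    rw [Fin.sum_univ_castSucc]
    rcases (h (Fin.last k)).eq_or_mem with heq | hmem
    · obtain ⟨w, hw, hle⟩ := ih (fun i => xs i.castSucc) (fun i => ys i.castSucc)
        fun i => h i.castSucc
      refine ⟨w, hw, (dist_triangle w (xs (Fin.last (k + 1))) _).trans ?_⟩
      rw [← Fin.succ_last, ← heq]
      gcongr
    · exact ⟨xs (Fin.last (k + 1)), Or.inr hmem.2,
        le_add_of_nonneg_left (Finset.sum_nonneg fun _ _ => dist_nonneg)⟩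

/-- The `D`-ball about `x` is contained in the union of the `d`-balls about `x` and about the
glued points. -/
theorem glueDist_ball_subset {T : Type*} [MetricSpace T] {J : ℕ} (u v : Fin J → T)
    (x : T) (r : ℝ) (hr : 0 < r) :
    { y : T | glueDist u v x y < r } ⊆
      Metric.ball x r ∪ ⋃ w ∈ glueSet u v, Metric.ball w r := by
  intro y hy
  rw [Set.mem_ofPred_eq, glueDist] at hy
  obtain ⟨s, ⟨k, xs, ys, rfl, rfl, hchain, rfl⟩, hs⟩ := exists_lt_of_csInf_lt
    (by exact ⟨dist x y, 0, fun _ => x, fun _ => y, rfl, rfl, fun i => i.elim0, by simp⟩) hy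
  obtain ⟨w, hw, hle⟩ := dist_le_sum_of_glue_chain xs ys hchain
  have hball : ys (Fin.last k) ∈ Metric.ball w r := Metric.mem_ball'.2 (hle.trans_lt hs)
  rcases hw with rfl | hw
  · exact Or.inl hball
  · exact Or.inr (Set.mem_biUnion hw hball)
end
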